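/- arXiv:1309.0066 — 11 statements merged into one kernel-verified Lean document; each statement's English description precedes it below -/
import Mathlib

section
/- Let l be any vertex of G, and let B be the real symmetric matrix indexed by V \ {l} with entries B_{ij} = A_{ij}/√(d_i d_j). Then every eigenvalue μ of B satisfies −1 < μ < 1; equivalently, the Dirichlet normalized Laplacian I − B has all its eigenvalues in the open interval (0, 2). -/
/-- Maximum principle: a function on a finite connected graph that is subharmonic away from `l`
attains its maximum at `l`. -/
theorem SimpleGraph.Connected.le_of_degree_mul_le_sum {V : Type*} [Fintype V]
    {G : SimpleGraph V} [DecidableRel G.Adj] (hconn : G.Connected) {l : V} {g : V → ℝ}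
    (hg : ∀ i, i ≠ l → (G.degree i : ℝ) * g i ≤ ∑ j ∈ G.neighborFinset i, g j) (i : V) :
    g i ≤ g l := by
  have : Nonempty V := ⟨l⟩
  obtain ⟨m, hm⟩ := Finite.exists_max g
  suffices h : g l = g m from h ▸ hm i
  by_contra hne
  have step : ∀ a b, G.Adj a b → g a = g m → g b = g m := by
    intro a b hab ha
    have hal : a ≠ l := by rintro rfl; exact hne ha
    have hsum : ∑ j ∈ G.neighborFinset a, g j = ∑ j ∈ G.neighborFinset a, g m := by
      refine le_antisymm (Finset.sum_le_sum fun j _ => hm j) ?_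
      simpa [ha] using hg a hal
    exact (Finset.sum_eq_sum_iff_of_le fun j _ => hm j).1 hsum b (by simpa using hab)
  have walk : ∀ {a b}, G.Walk a b → g a = g m → g b = g m := by
    intro a b p
    induction p with
    | nil => exact id
    | cons hab _ ih => exact fun ha => ih (step _ _ hab ha)
  obtain ⟨p⟩ := hconn.preconnected m l
  exact hne (walk p rfl)

/-- For a finite connected simple graph `G` on at least 2 vertices and
a vertex `l`, the matrix `B` indexed by `V \ {l}` with entries
`B i j = A i j / √(d i * d j)` has all its eigenvalues in the open interval `(-1, 1)`. -/
theorem dirichlet_normalized_adjacency_eigenvalues {V : Type*} [Fintype V] [DecidableEq V]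
    (G : SimpleGraph V) [DecidableRel G.Adj]
    (hconn : G.Connected) (hcard : 2 ≤ Fintype.card V) (l : V)
    (B : Matrix {i : V // i ≠ l} {i : V // i ≠ l} ℝ)
    (hB : ∀ i j : {i : V // i ≠ l},
      B i j = G.adjMatrix ℝ i.1 j.1 / Real.sqrt ((G.degree i.1 : ℝ) * (G.degree j.1 : ℝ))) :
    ∀ (μ : ℝ) (v : {i : V // i ≠ l} → ℝ), v ≠ 0 → B.mulVec v = μ • v → -1 < μ ∧ μ < 1 := by
  intro μ v hv hμ
  have : Nontrivial V := Fintype.one_lt_card_iff_nontrivial.1 hcard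
  have hdeg : ∀ i, 0 < (G.degree i : ℝ) := fun i => by
    exact_mod_cast hconn.preconnected.degree_pos_of_nontrivial i
  rw [← abs_lt]
  by_contra! hlt
  let f : V → ℝ := fun i => if h : i ≠ l then v ⟨i, h⟩ / √(G.degree i : ℝ) else 0
  have hfl : f l = 0 := by simp [f]
  have hfv : ∀ j : {i : V // i ≠ l}, f j.1 = v j / √(G.degree j.1 : ℝ) := fun j => by
    simp [f, j.2]
  have heq : ∀ i, i ≠ l → ∑ j ∈ G.neighborFinset i, f j = μ * ((G.degree i : ℝ) * f i) := by
    intro i hi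
    have hi' := congrFun hμ ⟨i, hi⟩
    have hsplit : ∑ j ∈ G.neighborFinset i, f j
        = ∑ j : {j : V // j ≠ l}, G.adjMatrix ℝ i j.1 * f j.1 := by
      rw [← SimpleGraph.adjMatrix_mulVec_apply, Matrix.mulVec, dotProduct,
        Fintype.sum_eq_add_sum_subtype_ne _ l, hfl, mul_zero, zero_add]
    have hsum : ∑ j : {j : V // j ≠ l}, G.adjMatrix ℝ i j.1 * f j.1
        = √(G.degree i : ℝ) * (B.mulVec v) ⟨i, hi⟩ := by
      rw [Matrix.mulVec, dotProduct, Finset.mul_sum]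
      refine Finset.sum_congr rfl fun j _ => ?_
      have h1 := Real.sqrt_pos.2 (hdeg i)
      have h2 := Real.sqrt_pos.2 (hdeg j.1)
      rw [hB, hfv, Real.sqrt_mul (hdeg i).le]
      field_simp
    have h1 := Real.sqrt_pos.2 (hdeg i)
    rw [hsplit, hsum, hi', hfv ⟨i, hi⟩, Pi.smul_apply, smul_eq_mul]
    nth_rewrite 2 [← Real.mul_self_sqrt (hdeg i).le]
    field_simp
  have hmax := hconn.le_of_degree_mul_le_sum (l := l) (g := fun i => |f i|) fun i hi => by
    calc (G.degree i : ℝ) * |f i| ≤ |μ| * ((G.degree i : ℝ) * |f i|) :=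
          le_mul_of_one_le_left (mul_nonneg (hdeg i).le (abs_nonneg _)) hlt
      _ = |∑ j ∈ G.neighborFinset i, f j| := by
          rw [heq i hi, abs_mul, abs_mul, abs_of_pos (hdeg i)]
      _ ≤ ∑ j ∈ G.neighborFinset i, |f j| := Finset.abs_sum_le_sum_abs _ _
  refine hv (funext fun j => ?_)
  have hj : f j.1 = 0 := by simpa [hfl] using hmax j.1
  rw [hfv, div_eq_zero_iff] at hj
  exact hj.resolve_right (Real.sqrt_pos.2 (hdeg j.1)).ne'
end

section
/- Fix vertices k ≠ l of G and define the affine map T on functions p : V → ℝ by: T(p)_l = 0, and for every vertex i ≠ l, T(p)_i = δ_{ik} + Σ_{j ∼ i, j ≠ l} p_j/d_j, where the sum runs over neighbors j of i other than l. Then T has a unique fixed point p*, and for every initial function p : V → ℝ, the iterates T^t(p) converge to p* (componentwise) as t → ∞. -/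
open Finset Filter

/-- A map that is a contraction for a weighted supremum norm on `ι → ℝ` has a unique fixed point,
which attracts all orbits. -/
theorem exists_unique_fixedPoint_of_weighted_contraction {ι : Type*} [Fintype ι]
    (T : (ι → ℝ) → ι → ℝ) (W : ι → ℝ) (hW : ∀ i, 0 < W i) (c : ℝ) (hc0 : 0 ≤ c) (hc1 : c < 1)
    (hT : ∀ (p q : ι → ℝ) (M : ℝ), 0 ≤ M → (∀ i, |p i - q i| ≤ M * W i) →
      ∀ i, |T p i - T q i| ≤ c * M * W i) :
    ∃ x : ι → ℝ, T x = x ∧ (∀ y, T y = y → y = x) ∧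
      ∀ p, Tendsto (fun t => T^[t] p) atTop (nhds x) := by
  let D : (ι → ℝ) → ι → ℝ := fun p i => W i * p i
  let E : (ι → ℝ) → ι → ℝ := fun p i => p i / W i
  have hDE : ∀ p, D (E p) = p := fun p => funext fun i => mul_div_cancel₀ _ (hW i).ne'
  have hED : ∀ p, E (D p) = p := fun p => funext fun i => mul_div_cancel_left₀ _ (hW i).ne'
  let F : (ι → ℝ) → ι → ℝ := fun p => E (T (D p))
  have hF : ContractingWith ⟨c, hc0⟩ F := by
    refine ⟨by exact_mod_cast hc1, LipschitzWith.of_dist_le_mul fun p q => ?_⟩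
    change dist (F p) (F q) ≤ c * dist p q
    refine (dist_pi_le_iff (mul_nonneg hc0 dist_nonneg)).2 fun i => ?_
    have h := hT (D p) (D q) (dist p q) dist_nonneg (fun i => by
      have h1 : |p i - q i| ≤ dist p q := dist_le_pi_dist p q i
      change |W i * p i - W i * q i| ≤ _
      rw [← mul_sub, abs_mul, abs_of_pos (hW i), mul_comm]
      exact mul_le_mul_of_nonneg_right h1 (hW i).le) i
    change |T (D p) i / W i - T (D q) i / W i| ≤ _
    rw [← sub_div, abs_div, abs_of_pos (hW i)]
    exact (div_le_iff₀ (hW i)).2 h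
  have hsemi : Function.Semiconj D F T := fun p => hDE _
  have hDcont : Continuous D := by fun_prop
  refine ⟨D (hF.fixedPoint F), ?_, fun y hy => ?_, fun p => ?_⟩
  · rw [← hsemi, hF.fixedPoint_isFixedPt]
  · have hfix : Function.IsFixedPt F (E y) := by
      change E (T (D (E y))) = E y
      rw [hDE, hy]
    rw [← hF.fixedPoint_unique hfix, hDE]
  · have h := (hDcont.tendsto _).comp (hF.tendsto_iterate_fixedPoint (E p))
    refine h.congr fun t => ?_
    rw [Function.comp_apply, (hsemi.iterate_right t) (E p), hDE]

/-- On a finite connected graph, the random walk killed at `l` admits a positive weight that is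
strictly superharmonic away from `l`. -/
theorem SimpleGraph.Connected.exists_strict_superharmonic {V : Type*} [Fintype V] [DecidableEq V]
    {G : SimpleGraph V} [DecidableRel G.Adj] (hconn : G.Connected) (l : V) :
    ∃ W : V → ℝ, (∀ i, 0 < W i) ∧
      ∀ i, i ≠ l → ∑ j ∈ (G.neighborFinset i).erase l, W j / (G.degree j : ℝ) < W i := by
  by_cases hsub : Subsingleton V
  · exact ⟨fun _ => 1, fun _ => one_pos, fun i hi => (hi (Subsingleton.elim i l)).elim⟩
  have : Nontrivial V := not_subsingleton_iff_nontrivial.1 hsub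
  have hdeg (i : V) : (0 : ℝ) < G.degree i := by
    exact_mod_cast hconn.preconnected.degree_pos_of_nontrivial i
  have hN : (1 : ℝ) < Fintype.card V := by exact_mod_cast Fintype.one_lt_card
  set a : ℝ := (Fintype.card V : ℝ)⁻¹ with ha
  have ha0 : 0 < a := inv_pos.2 (by linarith)
  have ha1 : a < 1 := inv_lt_one_of_one_lt₀ hN
  have hda (i : V) : G.degree i * a < 1 := by
    rw [ha, ← div_eq_mul_inv, div_lt_one (by linarith)]
    exact_mod_cast G.degree_lt_card_verts i
  let w : V → ℝ := fun i => 1 - a ^ G.dist i l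
  have hw (i : V) (hi : i ≠ l) : 0 < w i :=
    sub_pos.2 (pow_lt_one₀ ha0.le ha1 (hconn.pos_dist_of_ne hi).ne')
  have hwl : w l = 0 := by simp [w]
  refine ⟨fun i => if i = l then 1 else G.degree i * w i, fun i => ?_, fun i hi => ?_⟩
  · dsimp only
    split_ifs with h
    · exact one_pos
    · exact mul_pos (hdeg i) (hw i h)
  · have hsum : ∑ j ∈ (G.neighborFinset i).erase l,
        (if j = l then 1 else G.degree j * w j) / (G.degree j : ℝ) =
        ∑ j ∈ G.neighborFinset i, w j := by
      rw [← Finset.sum_erase (G.neighborFinset i) hwl]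
      refine Finset.sum_congr rfl fun j hj => ?_
      rw [if_neg (Finset.ne_of_mem_erase hj), mul_div_cancel_left₀ _ (hdeg j).ne']
    simp only [hsum, if_neg hi]
    obtain ⟨m, him, hm⟩ : ∃ m, G.Adj i m ∧ G.dist i l = G.dist m l + 1 := by
      obtain ⟨p, hp⟩ := hconn.exists_walk_length_eq_dist i l
      cases p with
      | nil => exact (hi rfl).elim
      | @cons _ m _ h q =>
        refine ⟨m, h, le_antisymm ?_ ?_⟩
        · have := hconn.dist_triangle (u := i) (v := m) (w := l)
          rw [SimpleGraph.dist_eq_one_iff_adj.2 h] at this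
          omega
        · rw [← hp, SimpleGraph.Walk.length_cons]
          exact Nat.succ_le_succ (SimpleGraph.dist_le q)
    have hpow : a ^ G.dist m l ≤ ∑ j ∈ G.neighborFinset i, a ^ G.dist j l :=
      Finset.single_le_sum (f := fun j => a ^ G.dist j l) (fun j _ => by positivity)
        ((G.mem_neighborFinset i m).2 him)
    have hlt : (G.degree i : ℝ) * a ^ G.dist i l < a ^ G.dist m l := by
      rw [hm, pow_succ]
      nlinarith [mul_lt_mul_of_pos_right (hda i) (pow_pos ha0 (G.dist m l))]
    simp only [w, Finset.sum_sub_distrib, Finset.sum_const,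
      SimpleGraph.card_neighborFinset_eq_degree, nsmul_eq_mul, mul_one]
    linarith

/-- Fix vertices `k ≠ l` of a finite connected simple graph `G`.
The affine map `T` on functions `p : V → ℝ` given by `T(p)_l = 0` and, for `i ≠ l`,
`T(p)_i = δ_{ik} + Σ_{j ∼ i, j ≠ l} p_j / d_j`, has a unique fixed point `p*`, and the
iterates `T^[t] p` converge (componentwise) to `p*` for every initial `p`. -/
theorem random_walk_load_map_unique_fixed_point {V : Type*} [Fintype V] [DecidableEq V]
    (G : SimpleGraph V) [DecidableRel G.Adj]
    (hconn : G.Connected) (hcard : 2 ≤ Fintype.card V)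
    (k l : V) (hkl : k ≠ l)
    (T : (V → ℝ) → (V → ℝ))
    (hTl : ∀ p : V → ℝ, T p l = 0)
    (hTi : ∀ (p : V → ℝ) (i : V), i ≠ l →
      T p i = (if i = k then (1 : ℝ) else 0) +
        ∑ j ∈ (G.neighborFinset i).erase l, p j / (G.degree j : ℝ)) :
    ∃ pstar : V → ℝ, T pstar = pstar ∧
      (∀ p' : V → ℝ, T p' = p' → p' = pstar) ∧
      (∀ p : V → ℝ, Tendsto (fun t => T^[t] p) atTop (nhds pstar)) := by
  obtain ⟨W, hW, hlt⟩ := hconn.exists_strict_superharmonic l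
  let S : V → ℝ := fun i => if i = l then 0 else
    ∑ j ∈ (G.neighborFinset i).erase l, W j / (G.degree j : ℝ)
  have hS0 (i : V) : 0 ≤ S i := by
    dsimp only [S]
    split_ifs
    · exact le_rfl
    · exact Finset.sum_nonneg fun j _ => div_nonneg (hW j).le (Nat.cast_nonneg _)
  have hS1 (i : V) : S i < W i := by
    dsimp only [S]
    split_ifs with h
    · exact hW i
    · exact hlt i h
  have : Nonempty V := ⟨l⟩
  obtain ⟨m, hm⟩ := Finite.exists_max fun i => S i / W i
  refine exists_unique_fixedPoint_of_weighted_contraction T W hW (S m / W m)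
    (div_nonneg (hS0 m) (hW m).le) ((div_lt_one (hW m)).2 (hS1 m)) fun p q M hM h i => ?_
  have hSi : M * S i ≤ S m / W m * M * W i := by
    have := mul_le_mul_of_nonneg_left ((div_le_iff₀ (hW i)).1 (hm i)) hM
    linarith
  refine le_trans ?_ hSi
  by_cases hi : i = l
  · rw [hi, hTl, hTl, sub_self, abs_zero]
    exact mul_nonneg hM (hS0 l)
  · rw [hTi p i hi, hTi q i hi, add_sub_add_left_eq_sub, ← Finset.sum_sub_distrib]
    simp only [S, if_neg hi]
    rw [Finset.mul_sum]
    refine (Finset.abs_sum_le_sum_abs _ _).trans (Finset.sum_le_sum fun j _ => ?_)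
    rw [← sub_div, abs_div, Nat.abs_cast, ← mul_div_assoc]
    exact div_le_div_of_nonneg_right (h j) (Nat.cast_nonneg _)
end

section
/- Fix vertices k ≠ l of G. If p : V → ℝ satisfies p_l = 0 and p_i = δ_{ik} + Σ_{j ∼ i, j ≠ l} p_j/d_j for every vertex i ≠ l (the sum over neighbors j of i other than l), then the total steady-state inflow into the destination l equals the injection rate: Σ_{j ∼ l} p_j/d_j = 1. -/
open Finset

/-- Summing a function over all neighborhoods counts each vertex with its degree. -/
lemma sum_sum_neighborFinset {V R : Type*} [Fintype V] [Semiring R]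
    (G : SimpleGraph V) [DecidableRel G.Adj] (f : V → R) :
    ∑ i, ∑ j ∈ G.neighborFinset i, f j = ∑ j, (G.degree j : R) * f j := by
  rw [Finset.sum_comm' (t' := univ) (s' := fun j => G.neighborFinset j)]
  · simp
  · intro i j
    simp [G.adj_comm]

/-- Fix vertices `k ≠ l`. If `p : V → ℝ` satisfies `p l = 0` and
`p i = δ_{ik} + Σ_{j ∼ i, j ≠ l} p j / d j` for every `i ≠ l`, then the total
steady-state inflow into the destination `l` equals the injection rate:
`Σ_{j ∼ l} p j / d j = 1`. -/
theorem steady_state_inflow_eq_one {V : Type*} [Fintype V] [DecidableEq V]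
    (G : SimpleGraph V) [DecidableRel G.Adj]
    (hconn : G.Connected) (hcard : 2 ≤ Fintype.card V)
    (k l : V) (hkl : k ≠ l)
    (p : V → ℝ) (hpl : p l = 0)
    (hp : ∀ i : V, i ≠ l →
      p i = (if i = k then (1 : ℝ) else 0) +
        ∑ j ∈ (G.neighborFinset i).erase l, p j / (G.degree j : ℝ)) :
    ∑ j ∈ G.neighborFinset l, p j / (G.degree j : ℝ) = 1 := by
  have : Nontrivial V := Fintype.one_lt_card_iff_nontrivial.mp hcard
  have hdeg : ∀ j, (G.degree j : ℝ) ≠ 0 := fun j =>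
    Nat.cast_ne_zero.mpr (hconn.preconnected.degree_pos_of_nontrivial j).ne'
  have htotal : ∑ i, ∑ j ∈ G.neighborFinset i, p j / (G.degree j : ℝ) = ∑ j, p j := by
    rw [sum_sum_neighborFinset]
    exact sum_congr rfl fun j _ => mul_div_cancel₀ (p j) (hdeg j)
  have hbalance : ∑ i ∈ univ.erase l, p i =
      1 + ∑ i ∈ univ.erase l, ∑ j ∈ G.neighborFinset i, p j / (G.degree j : ℝ) := by
    calc ∑ i ∈ univ.erase l, p i
        = ∑ i ∈ univ.erase l, ((if i = k then (1 : ℝ) else 0) +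
            ∑ j ∈ G.neighborFinset i, p j / (G.degree j : ℝ)) := by
          refine sum_congr rfl fun i hi => ?_
          rw [hp i (ne_of_mem_erase hi), sum_erase _ (by simp [hpl])]
      _ = _ := by simp [sum_add_distrib, hkl]
  rw [← add_sum_erase univ _ (mem_univ l), ← add_sum_erase univ p (mem_univ l)] at htotal
  linarith
end

section
/- For each ordered pair of vertices (k, l) with k ≠ l, let r^{kl} be the unique vector with (L r^{kl})_i = δ_{ik} − δ_{il} for all i and r^{kl}_l = 0. Then for every vertex j, Σ_{l ∈ V} Σ_{k ∈ V, k ≠ l} r^{kl}_j = N · Σ_{α=1}^{N−1} 1/λ_α. Consequently, the steady-state load Λ_j = (N − 1) + d_j Σ_{l} Σ_{k ≠ l} r^{kl}_j at vertex j equals (N − 1) + N d_j Σ_{α=1}^{N−1} 1/λ_α, and in particular is a linear function of the degree d_j with slope independent of j. -/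
open Finset

/-- An orthonormal family of real vectors indexed by a type of full cardinality is complete. -/
lemma sum_mul_eq_ite_of_orthonormal {ι V : Type*} [Fintype ι] [DecidableEq ι] [Fintype V]
    [DecidableEq V] (hcard : Fintype.card ι = Fintype.card V) {ξ : ι → V → ℝ}
    (horth : ∀ α β, ∑ i, ξ α i * ξ β i = if α = β then (1 : ℝ) else 0) (i j : V) :
    ∑ α, ξ α i * ξ α j = if i = j then (1 : ℝ) else 0 := by
  have hleft : Matrix.of ξ * (Matrix.of ξ).transpose = 1 := by
    ext α β
    simp [Matrix.mul_apply, Matrix.one_apply, horth]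
  have hright := (Matrix.mul_eq_one_comm_of_equiv (Fintype.equivOfCardEq hcard)).mp hleft
  simpa [Matrix.mul_apply, Matrix.one_apply] using congrFun (congrFun hright i) j

/-- Expansion of a vector in a complete family. -/
lemma eq_sum_dotProduct_mul {ι V : Type*} [Fintype ι] [Fintype V] [DecidableEq V]
    {ξ : ι → V → ℝ} (hcomplete : ∀ i j, ∑ α, ξ α i * ξ α j = if i = j then (1 : ℝ) else 0)
    (f : V → ℝ) (j : V) : f j = ∑ α, ξ α ⬝ᵥ f * ξ α j := by
  simp only [dotProduct, sum_mul]
  rw [sum_comm]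
  calc f j = ∑ i, f i * ∑ α, ξ α i * ξ α j := by simp [hcomplete]
    _ = _ := sum_congr rfl fun i _ => by
      rw [mul_sum]
      exact sum_congr rfl fun α _ => by ring

namespace SimpleGraph

variable {V : Type*} [Fintype V] [DecidableEq V] (G : SimpleGraph V) [DecidableRel G.Adj]

/-- Pairing the image of the Laplacian with an eigenvector. -/
lemma dotProduct_lapMatrix_mulVec_of_eigenvector {ξ : V → ℝ} {c : ℝ}
    (hξ : (G.lapMatrix ℝ).mulVec ξ = c • ξ) (f : V → ℝ) :
    ξ ⬝ᵥ (G.lapMatrix ℝ).mulVec f = c * ξ ⬝ᵥ f := by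
  rw [Matrix.dotProduct_mulVec, ← Matrix.mulVec_transpose, (G.isSymm_lapMatrix (R := ℝ)).eq, hξ,
    smul_dotProduct, smul_eq_mul]

/-- Laplacian eigenvectors with nonzero eigenvalue have zero sum. -/
lemma sum_eq_zero_of_lapMatrix_eigenvector {ξ : V → ℝ} {c : ℝ}
    (hξ : (G.lapMatrix ℝ).mulVec ξ = c • ξ) (hc : c ≠ 0) : ∑ i, ξ i = 0 := by
  have h := G.dotProduct_lapMatrix_mulVec_of_eigenvector hξ (fun _ => 1)
  rw [G.lapMatrix_mulVec_const_eq_zero] at h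
  simpa [dotProduct, hc] using h.symm

end SimpleGraph

/-- For each ordered pair `(k,l)` with `k ≠ l`, let `r^{kl}` be the unique
vector with `(L r^{kl})_i = δ_{ik} - δ_{il}` and `r^{kl}_l = 0`. Then for every vertex `j`,
`Σ_l Σ_{k ≠ l} r^{kl}_j = N Σ_{α≠0} 1/λ_α`, and consequently the steady-state load
`Λ_j = (N-1) + d_j Σ_l Σ_{k≠l} r^{kl}_j` equals `(N-1) + N d_j Σ_{α≠0} 1/λ_α`. -/
theorem steady_state_load_formula {V : Type*} [Fintype V] [DecidableEq V]
    (G : SimpleGraph V) [DecidableRel G.Adj]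
    (hconn : G.Connected) (N : ℕ) (hN : Fintype.card V = N) (hN2 : 2 ≤ N)
    (lam : Fin N → ℝ) (ξ : Fin N → V → ℝ)
    (horth : ∀ α β : Fin N, ∑ i : V, ξ α i * ξ β i = if α = β then (1 : ℝ) else 0)
    (heig : ∀ α : Fin N, (G.lapMatrix ℝ).mulVec (ξ α) = lam α • ξ α)
    (hzero : lam ⟨0, by omega⟩ = 0)
    (hpos : ∀ α : Fin N, α ≠ ⟨0, by omega⟩ → 0 < lam α)
    (r : V → V → V → ℝ)
    (hr : ∀ k l : V, k ≠ l →
      (∀ i : V, (G.lapMatrix ℝ).mulVec (r k l) i =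
        (if i = k then (1 : ℝ) else 0) - (if i = l then (1 : ℝ) else 0)) ∧ r k l l = 0) :
    ∀ j : V,
      (∑ l : V, ∑ k ∈ Finset.univ.erase l, r k l j) =
        N * ∑ α ∈ Finset.univ.erase (⟨0, by omega⟩ : Fin N), 1 / lam α ∧
      ((N : ℝ) - 1) + (G.degree j : ℝ) * (∑ l : V, ∑ k ∈ Finset.univ.erase l, r k l j) =
        ((N : ℝ) - 1) + N * (G.degree j : ℝ) *
          ∑ α ∈ Finset.univ.erase (⟨0, by omega⟩ : Fin N), 1 / lam α := by
  intro j
  have hcomplete := sum_mul_eq_ite_of_orthonormal (by simp [hN]) horth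
  set o : Fin N := ⟨0, by omega⟩ with ho
  have hconst : ∀ i i', ξ o i = ξ o i' := fun i i' =>
    (G.lapMatrix_mulVec_eq_zero_iff_forall_reachable.mp (by rw [heig, hzero, zero_smul])) i i'
      (hconn.preconnected i i')
  have hsum : ∀ α ∈ univ.erase o, ∑ i, ξ α i = 0 := fun α hα =>
    G.sum_eq_zero_of_lapMatrix_eigenvector (heig α) (hpos α (ne_of_mem_erase hα)).ne'
  have hcoeff : ∀ l, ∀ α ∈ univ.erase o,
      ξ α ⬝ᵥ (∑ k ∈ univ.erase l, r k l) = -(N * ξ α l) / lam α := by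
    intro l α hα
    rw [eq_div_iff (hpos α (ne_of_mem_erase hα)).ne', mul_comm,
      ← G.dotProduct_lapMatrix_mulVec_of_eigenvector (heig α), Matrix.mulVec_sum, dotProduct_sum]
    calc ∑ k ∈ univ.erase l, ξ α ⬝ᵥ (G.lapMatrix ℝ).mulVec (r k l)
        = ∑ k ∈ univ.erase l, (ξ α k - ξ α l) := sum_congr rfl fun k hk => by
          simp [dotProduct, (hr k l (ne_of_mem_erase hk)).1, mul_sub]
      _ = ∑ k, (ξ α k - ξ α l) := sum_erase _ (sub_self _)
      _ = -(N * ξ α l) := by simp [hsum α hα, hN]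
  have hload : ∀ l, ∑ k ∈ univ.erase l, r k l j =
      ∑ α ∈ univ.erase o, N * (1 / lam α) * (ξ α l * ξ α l - ξ α j * ξ α l) := by
    intro l
    have hl : (∑ k ∈ univ.erase l, r k l) l = 0 := by
      rw [Finset.sum_apply]
      exact sum_eq_zero fun k hk => (hr k l (ne_of_mem_erase hk)).2
    rw [← Finset.sum_apply, ← sub_zero ((∑ k ∈ univ.erase l, r k l) j), ← hl,
      eq_sum_dotProduct_mul hcomplete (∑ k ∈ univ.erase l, r k l) j,
      eq_sum_dotProduct_mul hcomplete (∑ k ∈ univ.erase l, r k l) l,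
      ← sum_sub_distrib, ← sum_erase _ (a := o) (by rw [hconst j l, sub_self])]
    exact sum_congr rfl fun α hα => by rw [hcoeff l α hα]; ring
  have hmain : ∑ l, ∑ k ∈ univ.erase l, r k l j = N * ∑ α ∈ univ.erase o, 1 / lam α := by
    simp_rw [hload]
    rw [sum_comm, mul_sum]
    refine sum_congr rfl fun α hα => ?_
    rw [← mul_sum, sum_sub_distrib, ← mul_sum, hsum α hα, horth]
    simp
  exact ⟨hmain, by rw [hmain]; ring⟩
end

section
/- Let 𝓛 = D^{−1/2} L D^{−1/2} be the normalized Laplacian of G, with eigenvalues 0 = ν_0 < ν_1 ≤ … ≤ ν_{N−1} counted with multiplicity and a corresponding orthonormal basis of eigenvectors {ζ^α}_{α=0}^{N−1} of ℝ^V. Then Σ_{α=1}^{N−1} 1/λ_α = Σ_{α=1}^{N−1} (1/ν_α) · [ Σ_{l ∈ V} (ζ^α_l)²/d_l − (1/N)( Σ_{l ∈ V} ζ^α_l/√(d_l) )² ]. -/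
open Finset Matrix

/-- The Parseval identity for an orthonormal family of `card ι` vectors in `ι → ℝ`. -/
theorem sum_dotProduct_mul_dotProduct_of_orthonormal {ι κ : Type*} [Fintype ι] [Fintype κ]
    [DecidableEq ι] [DecidableEq κ] (hcard : Fintype.card κ = Fintype.card ι) (ξ : κ → ι → ℝ)
    (horth : ∀ α β, ∑ i, ξ α i * ξ β i = if α = β then (1 : ℝ) else 0) (u v : ι → ℝ) :
    ∑ α, (ξ α ⬝ᵥ u) * (ξ α ⬝ᵥ v) = u ⬝ᵥ v := by
  have hQ : Matrix.of ξ * (Matrix.of ξ)ᵀ = 1 := by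
    ext α β
    simpa [Matrix.mul_apply, Matrix.one_apply] using horth α β
  have hQ' : (Matrix.of ξ)ᵀ * Matrix.of ξ = 1 :=
    (Matrix.mul_eq_one_comm_of_card_eq κ ι ℝ hcard).1 hQ
  change (Matrix.of ξ *ᵥ u) ⬝ᵥ (Matrix.of ξ *ᵥ v) = u ⬝ᵥ v
  rw [Matrix.dotProduct_mulVec, Matrix.vecMul_mulVec, ← Matrix.dotProduct_mulVec, hQ',
    Matrix.one_mulVec]

/-- For a unit vector `ξ` in the kernel of the Laplacian of a connected graph,
`(ξ ⬝ᵥ x) ^ 2` is the squared coordinate sum of `x` divided by the number of vertices. -/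
theorem SimpleGraph.Connected.sq_dotProduct_of_lapMatrix_mulVec_eq_zero {V : Type*} [Fintype V]
    [DecidableEq V] {G : SimpleGraph V} [DecidableRel G.Adj] (hconn : G.Connected) {ξ : V → ℝ}
    (hker : G.lapMatrix ℝ *ᵥ ξ = 0) (hnorm : ξ ⬝ᵥ ξ = 1) (x : V → ℝ) :
    (ξ ⬝ᵥ x) ^ 2 = 1 / (Fintype.card V : ℝ) * (∑ l, x l) ^ 2 := by
  obtain ⟨i₀⟩ := hconn.nonempty
  have hconst : ξ = fun _ => ξ i₀ := funext fun i =>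
    (G.lapMatrix_mulVec_eq_zero_iff_forall_reachable.1 hker) i i₀ (hconn.preconnected i i₀)
  generalize ξ i₀ = k at hconst
  subst hconst
  have hk : (Fintype.card V : ℝ) * k ^ 2 = 1 := by
    simpa [dotProduct, pow_two] using hnorm
  have hcard : (Fintype.card V : ℝ) ≠ 0 := left_ne_zero_of_mul_eq_one hk
  simp only [dotProduct, ← Finset.mul_sum]
  field_simp
  linear_combination (∑ l, x l) ^ 2 * hk

/-- Pairing an eigenvector of `L` of eigenvalue `a` with `D^{-1/2} z`, for `z` an eigenvector of
`D^{-1/2} L D^{-1/2}` of eigenvalue `b`; the weights `s` are the diagonal entries of `D^{1/2}`. -/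
theorem eigenvalue_mul_dotProduct_div_of_normalized {ι : Type*} [Fintype ι]
    {L M : Matrix ι ι ℝ} (hL : L.IsSymm) {s : ι → ℝ} (hs : ∀ i, s i ≠ 0)
    (hM : ∀ i j, M i j = L i j / (s i * s j)) {a b : ℝ} {x z : ι → ℝ}
    (hx : L *ᵥ x = a • x) (hz : M *ᵥ z = b • z) :
    a * (x ⬝ᵥ (z / s)) = b * (x ⬝ᵥ (z * s)) := by
  have hLz : L *ᵥ (z / s) = b • (z * s) := by
    ext i
    have hi : ∑ j, M i j * z j = b * z i := congrFun hz i
    change ∑ j, L i j * (z j / s j) = b * (z i * s i)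
    rw [← mul_assoc, ← hi, Finset.sum_mul]
    refine Finset.sum_congr rfl fun j _ => ?_
    have := hs i
    have := hs j
    rw [hM]
    field_simp
  rw [← smul_eq_mul, ← smul_dotProduct, ← hx, ← smul_eq_mul, ← dotProduct_smul, ← hLz,
    Matrix.dotProduct_mulVec, ← Matrix.mulVec_transpose, hL.eq]

/-- Let `𝓛 = D^{-1/2} L D^{-1/2}` be the normalized Laplacian, with
eigenvalues `ν_α` (exactly one of which is zero) and corresponding orthonormal
eigenbasis `{ζ^α}`, and let `λ_α` be the eigenvalues of the Laplacian `L` (with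
orthonormal eigenbasis `{ξ^α}`, `λ_0 = 0`). Then
`Σ_{α≠0} 1/λ_α = Σ_{α≠0} (1/ν_α) [ Σ_l (ζ^α_l)²/d_l - (1/N)(Σ_l ζ^α_l/√(d_l))² ]`. -/
theorem laplacian_normalized_laplacian_spectral_identity {V : Type*} [Fintype V]
    [DecidableEq V] (G : SimpleGraph V) [DecidableRel G.Adj]
    (hconn : G.Connected) (N : ℕ) (hN : Fintype.card V = N) (hN2 : 2 ≤ N)
    (lam : Fin N → ℝ) (ξ : Fin N → V → ℝ)
    (horth : ∀ α β : Fin N, ∑ i : V, ξ α i * ξ β i = if α = β then (1 : ℝ) else 0)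
    (heig : ∀ α : Fin N, (G.lapMatrix ℝ).mulVec (ξ α) = lam α • ξ α)
    (hzero : lam ⟨0, by omega⟩ = 0)
    (hpos : ∀ α : Fin N, α ≠ ⟨0, by omega⟩ → 0 < lam α)
    (NL : Matrix V V ℝ)
    (hNL : ∀ i j : V, NL i j =
      G.lapMatrix ℝ i j / (Real.sqrt (G.degree i : ℝ) * Real.sqrt (G.degree j : ℝ)))
    (nu : Fin N → ℝ) (ζ : Fin N → V → ℝ)
    (horthζ : ∀ α β : Fin N, ∑ i : V, ζ α i * ζ β i = if α = β then (1 : ℝ) else 0)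
    (heigζ : ∀ α : Fin N, NL.mulVec (ζ α) = nu α • ζ α)
    (hzeroζ : nu ⟨0, by omega⟩ = 0)
    (hposζ : ∀ α : Fin N, α ≠ ⟨0, by omega⟩ → 0 < nu α) :
    ∑ α ∈ Finset.univ.erase (⟨0, by omega⟩ : Fin N), 1 / lam α =
      ∑ α ∈ Finset.univ.erase (⟨0, by omega⟩ : Fin N), (1 / nu α) *
        ((∑ l : V, (ζ α l) ^ 2 / (G.degree l : ℝ)) -
          (1 / (N : ℝ)) * (∑ l : V, ζ α l / Real.sqrt (G.degree l : ℝ)) ^ 2) := by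
  subst hN
  have : Nontrivial V := Fintype.one_lt_card_iff_nontrivial.1 hN2
  set o : Fin (Fintype.card V) := ⟨0, by omega⟩
  set s : V → ℝ := fun i => Real.sqrt (G.degree i : ℝ) with hsdef
  have hdeg (i : V) : (0 : ℝ) < G.degree i := by
    exact_mod_cast hconn.preconnected.degree_pos_of_nontrivial i
  have hs (i : V) : s i ≠ 0 := (Real.sqrt_pos.2 (hdeg i)).ne'
  have hcard : Fintype.card (Fin (Fintype.card V)) = Fintype.card V := Fintype.card_fin _
  have hker : G.lapMatrix ℝ *ᵥ ξ o = 0 := by rw [heig, hzero, zero_smul]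
  have hpair (α β) : lam α * (ξ α ⬝ᵥ (ζ β / s)) = nu β * (ξ α ⬝ᵥ (ζ β * s)) :=
    eigenvalue_mul_dotProduct_div_of_normalized (G.isSymm_lapMatrix ℝ) hs hNL (heig α) (heigζ β)
  have hbracket (β) : (∑ l : V, (ζ β l) ^ 2 / (G.degree l : ℝ)) -
      (1 / (Fintype.card V : ℝ)) * (∑ l : V, ζ β l / Real.sqrt (G.degree l : ℝ)) ^ 2 =
      ∑ α ∈ univ.erase o, (ξ α ⬝ᵥ (ζ β / s)) ^ 2 := by
    have hparseval := sum_dotProduct_mul_dotProduct_of_orthonormal hcard ξ horth (ζ β / s) (ζ β / s)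
    have hconst := hconn.sq_dotProduct_of_lapMatrix_mulVec_eq_zero hker
      (by simpa [dotProduct] using horth o o) (ζ β / s)
    have hnorm : (ζ β / s) ⬝ᵥ (ζ β / s) = ∑ l : V, (ζ β l) ^ 2 / (G.degree l : ℝ) := by
      refine Finset.sum_congr rfl fun l _ => ?_
      simp only [Pi.div_apply, hsdef]
      rw [← pow_two, div_pow, Real.sq_sqrt (hdeg l).le]
    rw [Finset.sum_erase_eq_sub (mem_univ o), hconst]
    simp only [pow_two] at hparseval hnorm ⊢
    rw [hparseval, hnorm]
    rfl
  simp_rw [hbracket, Finset.mul_sum]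
  rw [Finset.sum_comm]
  refine Finset.sum_congr rfl fun α hα => ?_
  have hα0 : lam α ≠ 0 := (hpos α (Finset.ne_of_mem_erase hα)).ne'
  have hzero_pair : ξ α ⬝ᵥ (ζ o / s) = 0 := by
    have h := hpair α o
    rw [hzeroζ, zero_mul] at h
    exact (mul_eq_zero.1 h).resolve_left hα0
  have hterm : ∀ β ∈ univ.erase o, 1 / nu β * (ξ α ⬝ᵥ (ζ β / s)) ^ 2 =
      1 / lam α * ((ξ α ⬝ᵥ (ζ β / s)) * (ξ α ⬝ᵥ (ζ β * s))) := by
    intro β hβ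
    have hβ0 : nu β ≠ 0 := (hposζ β (Finset.ne_of_mem_erase hβ)).ne'
    field_simp
    linear_combination (ξ α ⬝ᵥ (ζ β / s)) * hpair α β
  have hdiv (β) : ξ α ⬝ᵥ (ζ β / s) = ζ β ⬝ᵥ (ξ α / s) :=
    Finset.sum_congr rfl fun i _ => by simp only [Pi.div_apply]; ring
  have hmul (β) : ξ α ⬝ᵥ (ζ β * s) = ζ β ⬝ᵥ (ξ α * s) :=
    Finset.sum_congr rfl fun i _ => by simp only [Pi.mul_apply]; ring
  have hunit : (ξ α / s) ⬝ᵥ (ξ α * s) = 1 := by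
    rw [← if_pos (rfl : α = α) (t := (1 : ℝ)) (e := 0), ← horth α α]
    refine Finset.sum_congr rfl fun i _ => ?_
    have := hs i
    simp only [Pi.div_apply, Pi.mul_apply]
    field_simp
  rw [Finset.sum_congr rfl hterm, ← Finset.mul_sum, Finset.sum_erase _ (by simp [hzero_pair])]
  simp_rw [hdiv, hmul]
  rw [sum_dotProduct_mul_dotProduct_of_orthonormal hcard ζ horthζ, hunit, mul_one]
end

section
/- Let J be the N × N all-ones matrix indexed by V, and set M = L + (1/N) J. Then M is invertible. -/
/-- The entries of the image of a vector under the Laplacian sum to zero. -/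
theorem SimpleGraph.sum_lapMatrix_mulVec {V R : Type*} [Fintype V] [DecidableEq V] [CommRing R]
    (G : SimpleGraph V) [DecidableRel G.Adj] (x : V → R) :
    ∑ i, (G.lapMatrix R).mulVec x i = 0 := by
  have h : (fun _ ↦ 1) ⬝ᵥ (G.lapMatrix R).mulVec x = 0 := by
    rw [Matrix.dotProduct_mulVec, ← Matrix.mulVec_transpose, G.isSymm_lapMatrix R,
      G.lapMatrix_mulVec_const_eq_zero, zero_dotProduct]
  simpa [dotProduct] using h

/-- Let `J` be the all-ones matrix indexed by `V` and
`M = L + (1/N) J`, where `L` is the Laplacian of the finite connected simple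
graph `G` and `N = |V|`. Then `M` is invertible. -/
theorem laplacian_plus_projector_invertible {V : Type*} [Fintype V] [DecidableEq V]
    (G : SimpleGraph V) [DecidableRel G.Adj]
    (hconn : G.Connected) (hcard : 2 ≤ Fintype.card V)
    (J : Matrix V V ℝ) (hJ : ∀ i j : V, J i j = 1)
    (M : Matrix V V ℝ) (hM : M = G.lapMatrix ℝ + ((Fintype.card V : ℝ))⁻¹ • J) :
    IsUnit M := by
  have hN : (Fintype.card V : ℝ) ≠ 0 := by
    have : Fintype.card V ≠ 0 := by lia
    exact_mod_cast this
  rw [Matrix.isUnit_iff_isUnit_det, isUnit_iff_ne_zero]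
  intro hdet
  obtain ⟨x, hx, hMx⟩ := Matrix.exists_mulVec_eq_zero_iff.mpr hdet
  have hJx (i : V) : J.mulVec x i = ∑ j, x j := by simp [Matrix.mulVec, dotProduct, hJ]
  have hrow (i : V) :
      (G.lapMatrix ℝ).mulVec x i + (Fintype.card V : ℝ)⁻¹ * ∑ j, x j = 0 := by
    simpa [hM, Matrix.add_mulVec, Matrix.smul_mulVec, hJx] using congrFun hMx i
  have hsum : ∑ j, x j = 0 := by
    have h := Finset.sum_eq_zero fun i (_ : i ∈ Finset.univ) ↦ hrow i
    rw [Finset.sum_add_distrib, G.sum_lapMatrix_mulVec] at h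
    simpa [hN] using h
  have hLx : (G.lapMatrix ℝ).mulVec x = 0 := by
    ext i
    simpa [hsum] using hrow i
  have hconst := G.lapMatrix_mulVec_eq_zero_iff_forall_reachable.mp hLx
  apply hx
  ext i
  have h : ∑ j, x j = Fintype.card V * x i := by
    simp [Finset.sum_congr rfl fun j _ ↦ hconst j i (hconn.preconnected j i)]
  simpa [hsum, hN] using h
end

section
/- There exist constants c, C > 0 such that for all integers w ≥ 2, c·w² log w ≤ Σ_{(m,n) ∈ {0,…,w−1}², (m,n) ≠ (0,0)} 1/(4 − 2cos(mπ/w) − 2cos(nπ/w)) ≤ C·w² log w. (This is the sum of reciprocals of the nonzero Laplacian eigenvalues of the w × w square grid graph, showing that for a two-dimensional lattice with N = w² nodes, Σ_{α≠0} 1/λ_α grows as N log N.) -/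
open Finset Real

lemma two_sub_two_mul_cos_le_sq (x : ℝ) : 2 - 2 * cos x ≤ x ^ 2 := by
  linarith [one_sub_sq_div_two_le_cos (x := x)]

/-- The eigenvalue contribution of one coordinate is at least `4 m² / w²`. -/
lemma four_mul_sq_div_sq_le_two_sub_two_mul_cos {m w : ℕ} (hm : m < w) :
    4 * (m : ℝ) ^ 2 / (w : ℝ) ^ 2 ≤ 2 - 2 * cos (m * π / w) := by
  have hw : (0 : ℝ) < w := by exact_mod_cast (Nat.zero_le m).trans_lt hm
  have hmw : (m : ℝ) ≤ w := by exact_mod_cast hm.le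
  have hpi := pi_pos
  have hx : |m * π / w| ≤ π := by
    rw [abs_of_nonneg (by positivity), div_le_iff₀ hw, mul_comm]
    gcongr
  have h := cos_le_one_sub_mul_cos_sq hx
  have e : 2 / π ^ 2 * (m * π / w) ^ 2 = 2 * (m : ℝ) ^ 2 / (w : ℝ) ^ 2 := by
    field_simp
  have e' : 4 * (m : ℝ) ^ 2 / (w : ℝ) ^ 2 = 2 * (2 * (m : ℝ) ^ 2 / (w : ℝ) ^ 2) := by
    ring
  linarith

lemma sum_range_product_succ {M : Type*} [AddCommMonoid M] (f : ℕ × ℕ → M) (k : ℕ) :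
    ∑ p ∈ range (k + 1) ×ˢ range (k + 1), f p =
      ∑ p ∈ range k ×ˢ range k, f p + ∑ m ∈ range k, f (m, k) +
        ∑ n ∈ range (k + 1), f (k, n) := by
  simp only [sum_product, sum_range_succ _ k, sum_add_distrib]

/-- The sum of `1 / (m² + n²)` over a square is comparable to a harmonic number; the term at
the origin vanishes. -/
lemma harmonic_le_sum_one_div_sq_add_sq_le (k : ℕ) :
    (harmonic k : ℝ) ≤
        ∑ p ∈ range (k + 1) ×ˢ range (k + 1), 1 / ((p.1 : ℝ) ^ 2 + (p.2 : ℝ) ^ 2) ∧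
      ∑ p ∈ range (k + 1) ×ˢ range (k + 1), 1 / ((p.1 : ℝ) ^ 2 + (p.2 : ℝ) ^ 2) ≤
        3 * (harmonic k : ℝ) := by
  induction k with
  | zero => simp
  | succ k ih =>
    rw [sum_range_product_succ, harmonic_succ]
    push_cast
    set a : ℝ := (k : ℝ) + 1 with ha
    have ha1 : 1 ≤ a := by simp [ha]
    have hbound : ∀ n : ℕ, n < k + 1 + 1 →
        1 / (2 * a ^ 2) ≤ 1 / ((n : ℝ) ^ 2 + a ^ 2) ∧
          1 / ((n : ℝ) ^ 2 + a ^ 2) ≤ 1 / a ^ 2 := by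
      intro n hn
      have hna : (n : ℝ) ≤ a := by
        rw [ha]; exact_mod_cast Nat.lt_succ_iff.mp hn
      have hsq : (n : ℝ) ^ 2 ≤ a ^ 2 := by gcongr
      constructor <;> apply one_div_le_one_div_of_le <;> first | positivity | nlinarith
    have hcol_lower := card_nsmul_le_sum (range (k + 1))
      (fun n : ℕ => 1 / ((n : ℝ) ^ 2 + a ^ 2)) (1 / (2 * a ^ 2))
      fun n hn => (hbound n (by have := mem_range.mp hn; omega)).1
    have hcol_upper := sum_le_card_nsmul (range (k + 1))
      (fun n : ℕ => 1 / ((n : ℝ) ^ 2 + a ^ 2)) (1 / a ^ 2)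
      fun n hn => (hbound n (by have := mem_range.mp hn; omega)).2
    have hrow_lower := card_nsmul_le_sum (range (k + 1 + 1))
      (fun n : ℕ => 1 / (a ^ 2 + (n : ℝ) ^ 2)) (1 / (2 * a ^ 2))
      fun n hn => by rw [add_comm (a ^ 2)]; exact (hbound n (mem_range.mp hn)).1
    have hrow_upper := sum_le_card_nsmul (range (k + 1 + 1))
      (fun n : ℕ => 1 / (a ^ 2 + (n : ℝ) ^ 2)) (1 / a ^ 2)
      fun n hn => by rw [add_comm (a ^ 2)]; exact (hbound n (mem_range.mp hn)).2
    simp only [card_range, nsmul_eq_mul, Nat.cast_add, Nat.cast_one, ← ha]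
      at hcol_lower hcol_upper hrow_lower hrow_upper
    have hlower : a⁻¹ ≤ a * (1 / (2 * a ^ 2)) + (a + 1) * (1 / (2 * a ^ 2)) := by
      have e : a * (1 / (2 * a ^ 2)) + (a + 1) * (1 / (2 * a ^ 2)) =
          a⁻¹ + 1 / (2 * a ^ 2) := by
        field_simp
        ring
      rw [e]
      exact le_add_of_nonneg_right (by positivity)
    have hupper : a * (1 / a ^ 2) + (a + 1) * (1 / a ^ 2) ≤ 3 * a⁻¹ := by
      rw [← add_mul, mul_one_div, ← div_eq_mul_inv, div_le_div_iff₀ (by positivity)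
        (by positivity)]
      nlinarith
    constructor <;> linarith [ih.1, ih.2]

/-- There are constants `c, C > 0` such that for all `w ≥ 2`,
`c w² log w ≤ Σ_{(m,n) ≠ (0,0)} 1/(4 - 2cos(mπ/w) - 2cos(nπ/w)) ≤ C w² log w`
— the sum of the reciprocals of the nonzero Laplacian eigenvalues of the `w × w`
square grid graph grows as `N log N` with `N = w²`. -/
theorem square_grid_inverse_eigenvalue_sum_order :
    ∃ c C : ℝ, 0 < c ∧ 0 < C ∧ ∀ w : ℕ, 2 ≤ w →
      c * (w : ℝ) ^ 2 * Real.log w ≤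
        (∑ mn ∈ (Finset.range w ×ˢ Finset.range w).erase (0, 0),
          1 / (4 - 2 * Real.cos ((mn.1 : ℝ) * Real.pi / w)
                 - 2 * Real.cos ((mn.2 : ℝ) * Real.pi / w))) ∧
      (∑ mn ∈ (Finset.range w ×ˢ Finset.range w).erase (0, 0),
          1 / (4 - 2 * Real.cos ((mn.1 : ℝ) * Real.pi / w)
                 - 2 * Real.cos ((mn.2 : ℝ) * Real.pi / w))) ≤
        C * (w : ℝ) ^ 2 * Real.log w := by
  refine ⟨1 / π ^ 2, 9 / 4, by positivity, by norm_num, fun w hw => ?_⟩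
  obtain ⟨k, rfl⟩ : ∃ k, w = k + 1 := ⟨w - 1, by omega⟩
  obtain ⟨hlow, hupp⟩ := harmonic_le_sum_one_div_sq_add_sq_le k
  rw [← sum_erase (a := ((0, 0) : ℕ × ℕ)) _ (by simp)] at hlow hupp
  have hlog_low := log_add_one_le_harmonic k
  have hlog_upp := harmonic_le_one_add_log k
  have hlog_mono : log k ≤ log ((k + 1 : ℕ) : ℝ) :=
    log_le_log (by exact_mod_cast (by omega : 0 < k)) (by push_cast; linarith)
  have hlog_two : log 2 ≤ log ((k + 1 : ℕ) : ℝ) :=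
    log_le_log (by norm_num) (by exact_mod_cast hw)
  have hlog_half := log_two_gt_d9
  generalize hW : k + 1 = w at *
  have hw0 : (0 : ℝ) < w := by exact_mod_cast (by omega : 0 < w)
  have hpos : ∀ p ∈ (range w ×ˢ range w).erase (0, 0),
      0 < (p.1 : ℝ) ^ 2 + (p.2 : ℝ) ^ 2 := by
    rintro ⟨m, n⟩ hp
    have hne : m ≠ 0 ∨ n ≠ 0 := by
      by_contra! h
      simp [h.1, h.2] at hp
    rcases hne with h | h <;> positivity
  have hmem : ∀ p ∈ (range w ×ˢ range w).erase (0, 0), p.1 < w ∧ p.2 < w := fun p hp => by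
    simpa using mem_of_mem_erase hp
  have heig : ∀ p ∈ (range w ×ˢ range w).erase (0, 0),
      4 * ((p.1 : ℝ) ^ 2 + (p.2 : ℝ) ^ 2) / (w : ℝ) ^ 2 ≤
        4 - 2 * cos ((p.1 : ℝ) * π / w) - 2 * cos ((p.2 : ℝ) * π / w) := fun p hp => by
    have h₁ := four_mul_sq_div_sq_le_two_sub_two_mul_cos (hmem p hp).1
    have h₂ := four_mul_sq_div_sq_le_two_sub_two_mul_cos (hmem p hp).2
    rw [mul_add, add_div]
    linarith
  constructor
  · calc 1 / π ^ 2 * (w : ℝ) ^ 2 * log w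
        ≤ 1 / π ^ 2 * (w : ℝ) ^ 2 * ∑ p ∈ (range w ×ˢ range w).erase (0, 0),
            1 / ((p.1 : ℝ) ^ 2 + (p.2 : ℝ) ^ 2) := by
          gcongr
          exact hlog_low.trans hlow
      _ ≤ _ := by
          rw [mul_sum]
          refine sum_le_sum fun p hp => ?_
          have hp0 := hpos p hp
          have h := heig p hp
          have h₁ := two_sub_two_mul_cos_le_sq ((p.1 : ℝ) * π / w)
          have h₂ := two_sub_two_mul_cos_le_sq ((p.2 : ℝ) * π / w)
          have e : 1 / π ^ 2 * (w : ℝ) ^ 2 * (1 / ((p.1 : ℝ) ^ 2 + (p.2 : ℝ) ^ 2)) =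
              1 / (((p.1 : ℝ) * π / w) ^ 2 + ((p.2 : ℝ) * π / w) ^ 2) := by
            field_simp
          rw [e]
          apply one_div_le_one_div_of_le
          · exact lt_of_lt_of_le (by positivity) h
          · linarith
  · calc _ ≤ (w : ℝ) ^ 2 / 4 * ∑ p ∈ (range w ×ˢ range w).erase (0, 0),
            1 / ((p.1 : ℝ) ^ 2 + (p.2 : ℝ) ^ 2) := by
          rw [mul_sum]
          refine sum_le_sum fun p hp => ?_
          have hp0 := hpos p hp
          refine (one_div_le_one_div_of_le (by positivity) (heig p hp)).trans_eq ?_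
          field_simp
      _ ≤ (w : ℝ) ^ 2 / 4 * (9 * log w) := by
          gcongr
          linarith
      _ = 9 / 4 * (w : ℝ) ^ 2 * log w := by ring
end

section
/- There exist constants c, C > 0 such that for all integers w ≥ 2, c·w³ ≤ Σ_{(m,n,p) ∈ {0,…,w−1}³, (m,n,p) ≠ (0,0,0)} 1/(6 − 2cos(mπ/w) − 2cos(nπ/w) − 2cos(pπ/w)) ≤ C·w³. (This is the sum of reciprocals of the nonzero Laplacian eigenvalues of the w × w × w cubic grid graph, showing that for a d-dimensional hypercubic lattice with d = 3 and N = w³ nodes, Σ_{α≠0} 1/λ_α grows linearly in N.) -/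
open Finset Real

/-- The reciprocal squared cube roots of `1, …, w` sum to at most three times the cube root
of `w`. -/
lemma sum_inv_sq_cbrt_le (a : ℕ → ℝ) (ha : ∀ n, 0 ≤ a n) (ha3 : ∀ n, a n ^ 3 = n) (w : ℕ) :
    ∑ m ∈ range w, 1 / a (m + 1) ^ 2 ≤ 3 * a w := by
  induction w with
  | zero => simpa using ha 0
  | succ k ih =>
    rw [sum_range_succ]
    have hdiff : a (k + 1) ^ 3 - a k ^ 3 = 1 := by
      rw [ha3, ha3]; push_cast; ring
    have hk := ha k
    have hlt : a k < a (k + 1) := lt_of_pow_lt_pow_left₀ 3 (ha _) (by linarith)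
    have hstep : 1 / a (k + 1) ^ 2 ≤ 3 * (a (k + 1) - a k) := by
      rw [div_le_iff₀ (by nlinarith)]
      nlinarith [mul_nonneg (sub_nonneg.2 hlt.le) (sub_nonneg.2 hlt.le),
        mul_nonneg (mul_nonneg (sub_nonneg.2 hlt.le) (sub_nonneg.2 hlt.le))
          (by linarith : 0 ≤ 2 * a (k + 1) + a k)]
    linarith

lemma three_mul_le_add_pow_six {x y z : ℝ} :
    3 * (x ^ 2 * (y ^ 2 * z ^ 2)) ≤ (x ^ 3) ^ 2 + (y ^ 3) ^ 2 + (z ^ 3) ^ 2 := by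
  have h : 0 ≤ (x ^ 2 + y ^ 2 + z ^ 2) *
      ((x ^ 2 - y ^ 2) ^ 2 + (y ^ 2 - z ^ 2) ^ 2 + (z ^ 2 - x ^ 2) ^ 2) := by positivity
  linarith

lemma four_mul_sq_div_sq_le {m w : ℕ} (hm : m < w) :
    4 * (m : ℝ) ^ 2 / (w : ℝ) ^ 2 ≤ 2 - 2 * cos ((m : ℝ) * π / w) := by
  have hw : (0 : ℝ) < w := by exact_mod_cast (Nat.zero_le m).trans_lt hm
  have hmw : (m : ℝ) ≤ w := by exact_mod_cast hm.le
  have habs : |(m : ℝ) * π / w| ≤ π := by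
    rw [abs_of_nonneg (by positivity), div_le_iff₀ hw]
    nlinarith [pi_pos]
  have h := cos_le_one_sub_mul_cos_sq habs
  have heq : 2 / π ^ 2 * ((m : ℝ) * π / w) ^ 2 = 2 * (m : ℝ) ^ 2 / (w : ℝ) ^ 2 := by
    field_simp
  rw [heq] at h
  have htwo : 4 * (m : ℝ) ^ 2 / (w : ℝ) ^ 2 = 2 * (2 * (m : ℝ) ^ 2 / (w : ℝ) ^ 2) := by ring
  linarith

/-- A nonzero eigenvalue of the cubic grid is at least a constant times
`((m + 1) (n + 1) (p + 1)) ^ (2 / 3) / w ^ 2`. -/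
lemma prod_sq_cbrt_le_eigenvalue (a : ℕ → ℝ) (ha3 : ∀ n, a n ^ 3 = n) {w m n p : ℕ}
    (hm : m < w) (hn : n < w) (hp : p < w) (hne : (m, (n, p)) ≠ (0, (0, 0))) :
    3 / (2 * (w : ℝ) ^ 2) * (a (m + 1) ^ 2 * (a (n + 1) ^ 2 * a (p + 1) ^ 2)) ≤
      6 - 2 * cos ((m : ℝ) * π / w) - 2 * cos ((n : ℝ) * π / w) - 2 * cos ((p : ℝ) * π / w) := by
  have hw : (0 : ℝ) < w := by exact_mod_cast (Nat.zero_le m).trans_lt hm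
  have hone : (1 : ℝ) ≤ (m : ℝ) ^ 2 + (n : ℝ) ^ 2 + (p : ℝ) ^ 2 := by
    have : 1 ≤ m ^ 2 + n ^ 2 + p ^ 2 := by
      by_contra! h
      simp_all
    exact_mod_cast this
  have hamgm := three_mul_le_add_pow_six (x := a (m + 1)) (y := a (n + 1)) (z := a (p + 1))
  rw [ha3, ha3, ha3] at hamgm
  push_cast at hamgm
  have hsq : 3 * (a (m + 1) ^ 2 * (a (n + 1) ^ 2 * a (p + 1) ^ 2)) ≤
      8 * ((m : ℝ) ^ 2 + (n : ℝ) ^ 2 + (p : ℝ) ^ 2) := by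
    nlinarith [sq_nonneg ((m : ℝ) - 1), sq_nonneg ((n : ℝ) - 1), sq_nonneg ((p : ℝ) - 1)]
  calc 3 / (2 * (w : ℝ) ^ 2) * (a (m + 1) ^ 2 * (a (n + 1) ^ 2 * a (p + 1) ^ 2))
      = 3 * (a (m + 1) ^ 2 * (a (n + 1) ^ 2 * a (p + 1) ^ 2)) / (2 * (w : ℝ) ^ 2) := by ring
    _ ≤ 8 * ((m : ℝ) ^ 2 + (n : ℝ) ^ 2 + (p : ℝ) ^ 2) / (2 * (w : ℝ) ^ 2) := by gcongr
    _ = 4 * (m : ℝ) ^ 2 / (w : ℝ) ^ 2 + 4 * (n : ℝ) ^ 2 / (w : ℝ) ^ 2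
        + 4 * (p : ℝ) ^ 2 / (w : ℝ) ^ 2 := by field_simp; ring
    _ ≤ _ := by
      linarith [four_mul_sq_div_sq_le hm, four_mul_sq_div_sq_le hn, four_mul_sq_div_sq_le hp]

/-- There are constants `c, C > 0` such that for all `w ≥ 2`,
`c w³ ≤ Σ_{(m,n,p) ≠ (0,0,0)} 1/(6 - 2cos(mπ/w) - 2cos(nπ/w) - 2cos(pπ/w)) ≤ C w³`
— the sum of the reciprocals of the nonzero Laplacian eigenvalues of the
`w × w × w` cubic grid graph grows linearly in `N = w³`. -/
theorem cubic_grid_inverse_eigenvalue_sum_order :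
    ∃ c C : ℝ, 0 < c ∧ 0 < C ∧ ∀ w : ℕ, 2 ≤ w →
      c * (w : ℝ) ^ 3 ≤
        (∑ mnp ∈ (Finset.range w ×ˢ Finset.range w ×ˢ Finset.range w).erase (0, (0, 0)),
          1 / (6 - 2 * Real.cos ((mnp.1 : ℝ) * Real.pi / w)
                 - 2 * Real.cos ((mnp.2.1 : ℝ) * Real.pi / w)
                 - 2 * Real.cos ((mnp.2.2 : ℝ) * Real.pi / w))) ∧
      (∑ mnp ∈ (Finset.range w ×ˢ Finset.range w ×ˢ Finset.range w).erase (0, (0, 0)),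
          1 / (6 - 2 * Real.cos ((mnp.1 : ℝ) * Real.pi / w)
                 - 2 * Real.cos ((mnp.2.1 : ℝ) * Real.pi / w)
                 - 2 * Real.cos ((mnp.2.2 : ℝ) * Real.pi / w))) ≤
        C * (w : ℝ) ^ 3 := by
  obtain ⟨a, ha0, ha3⟩ : ∃ a : ℕ → ℝ, (∀ n, 0 ≤ a n) ∧ ∀ n, a n ^ 3 = n :=
    ⟨fun n ↦ (n : ℝ) ^ ((3 : ℕ) : ℝ)⁻¹, fun n ↦ by positivity,
      fun n ↦ rpow_inv_natCast_pow n.cast_nonneg (by norm_num)⟩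
  have hapos (n : ℕ) : 0 < a (n + 1) := by
    refine (ha0 _).lt_of_ne' fun h ↦ ?_
    have := ha3 (n + 1)
    rw [h] at this
    norm_cast at this
  refine ⟨1 / 24, 18, by norm_num, by norm_num, fun w hw ↦ ?_⟩
  have hw2 : (2 : ℝ) ≤ w := by exact_mod_cast hw
  have hlow : ∀ x ∈ (range w ×ˢ range w ×ˢ range w).erase (0, (0, 0)),
      3 / (2 * (w : ℝ) ^ 2) * (a (x.1 + 1) ^ 2 * (a (x.2.1 + 1) ^ 2 * a (x.2.2 + 1) ^ 2)) ≤
      6 - 2 * cos ((x.1 : ℝ) * π / w) - 2 * cos ((x.2.1 : ℝ) * π / w)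
        - 2 * cos ((x.2.2 : ℝ) * π / w) := by
    rintro ⟨m, n, p⟩ hx
    simp only [mem_erase, mem_product, mem_range] at hx
    exact prod_sq_cbrt_le_eigenvalue a ha3 hx.2.1 hx.2.2.1 hx.2.2.2 hx.1
  have hpos (x : ℕ × ℕ × ℕ) : 0 < 3 / (2 * (w : ℝ) ^ 2) *
      (a (x.1 + 1) ^ 2 * (a (x.2.1 + 1) ^ 2 * a (x.2.2 + 1) ^ 2)) := by
    have := hapos x.1
    have := hapos x.2.1
    have := hapos x.2.2
    positivity
  constructor
  · have hcard : (((range w ×ˢ range w ×ˢ range w).erase (0, (0, 0))).card : ℝ)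
        = (w : ℝ) ^ 3 - 1 := by
      rw [card_erase_of_mem (by simp; omega), Nat.cast_sub]
      · simp; ring
      · exact card_pos.2 ⟨(0, (0, 0)), by simp; omega⟩
    calc 1 / 24 * (w : ℝ) ^ 3 ≤ ((w : ℝ) ^ 3 - 1) * (1 / 12) := by
          have := pow_le_pow_left₀ (by norm_num) hw2 3
          linarith
      _ = ∑ _x ∈ (range w ×ˢ range w ×ˢ range w).erase (0, (0, 0)), (1 / 12 : ℝ) := by
          rw [sum_const, nsmul_eq_mul, hcard]
      _ ≤ _ := by
          refine sum_le_sum fun x hx ↦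
            one_div_le_one_div_of_le ((hpos x).trans_le (hlow x hx)) ?_
          linarith [neg_one_le_cos ((x.1 : ℝ) * π / w), neg_one_le_cos ((x.2.1 : ℝ) * π / w),
            neg_one_le_cos ((x.2.2 : ℝ) * π / w)]
  · set S : ℝ := ∑ m ∈ range w, 1 / a (m + 1) ^ 2 with hS
    have hS0 : 0 ≤ S := sum_nonneg fun m _ ↦ by positivity
    calc _ ≤ ∑ x ∈ (range w ×ˢ range w ×ˢ range w).erase (0, (0, 0)), 1 / (3 / (2 * (w : ℝ) ^ 2) *
            (a (x.1 + 1) ^ 2 * (a (x.2.1 + 1) ^ 2 * a (x.2.2 + 1) ^ 2))) :=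
          sum_le_sum fun x hx ↦ one_div_le_one_div_of_le (hpos x) (hlow x hx)
      _ ≤ ∑ x ∈ range w ×ˢ range w ×ˢ range w, 1 / (3 / (2 * (w : ℝ) ^ 2) *
            (a (x.1 + 1) ^ 2 * (a (x.2.1 + 1) ^ 2 * a (x.2.2 + 1) ^ 2))) :=
          sum_le_sum_of_subset_of_nonneg (erase_subset _ _)
            fun x _ _ ↦ (one_div_pos.2 (hpos x)).le
      _ = 2 * (w : ℝ) ^ 2 / 3 * (S * (S * S)) := by
          rw [hS, sum_mul_sum, ← sum_product', sum_mul_sum, ← sum_product', mul_sum]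
          refine sum_congr rfl fun x _ ↦ ?_
          simp only [one_div, mul_inv, inv_div]
      _ ≤ 2 * (w : ℝ) ^ 2 / 3 * (3 * a w) ^ 3 := by
          have := pow_le_pow_left₀ hS0 (sum_inv_sq_cbrt_le a ha0 ha3 w) 3
          gcongr
          linarith
      _ = 18 * (w : ℝ) ^ 3 := by
          rw [mul_pow, ha3]; ring
end

section
/- Let q ≥ 3 be an integer and n ≥ 1, and let S_n be the n × n tridiagonal matrix with diagonal entries (S_n)_{ii} = q for 1 ≤ i ≤ n−1 and (S_n)_{nn} = 1, superdiagonal entries (S_n)_{i,i+1} = −(q−1), subdiagonal entries (S_n)_{i+1,i} = −1, and all other entries zero. Then the trace of S_n^{−1} equals [ (q−1)^{n+1} − (q−1) − n(q−2) ] / (q−2)². -/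
/-- Row `i`, column `j` of the inverse sector matrix is `sectorSum r (i + 1) j`, where `r = q - 1`. -/
noncomputable def sectorSum (r : ℝ) (i j : ℕ) : ℝ :=
  ∑ k ∈ Finset.range i, if k ≤ j then r ^ (j - k) else 0

theorem sectorSum_succ (r : ℝ) (i j : ℕ) :
    sectorSum r (i + 1) j = sectorSum r i j + if i ≤ j then r ^ (j - i) else 0 :=
  Finset.sum_range_succ _ _

theorem sectorSum_zero (r : ℝ) (j : ℕ) : sectorSum r 0 j = 0 :=
  Finset.sum_range_zero _

theorem sectorSum_succ_self (r : ℝ) (i : ℕ) :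
    sectorSum r (i + 1) i = ∑ k ∈ Finset.range (i + 1), r ^ k := by
  rw [← Finset.sum_range_reflect, sectorSum]
  refine Finset.sum_congr rfl fun k hk => ?_
  rw [if_pos (Nat.lt_succ_iff.mp (Finset.mem_range.mp hk))]
  congr 1

theorem sum_fin_ite_val_eq (n m : ℕ) (f : ℕ → ℝ) :
    ∑ k : Fin n, (if (k : ℕ) = m then f k else 0) = if m < n then f m else 0 := by
  rw [Fin.sum_univ_eq_sum_range (fun k => if k = m then f k else 0) n]
  simp [Finset.sum_ite_eq']

theorem sum_sectorSum_succ_self {r : ℝ} (hr : r ≠ 1) (n : ℕ) :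
    ∑ i ∈ Finset.range n, sectorSum r (i + 1) i =
      (r ^ (n + 1) - r - n * (r - 1)) / (r - 1) ^ 2 := by
  have h : r - 1 ≠ 0 := sub_ne_zero.mpr hr
  induction n with
  | zero => simp
  | succ n ih =>
    rw [Finset.sum_range_succ, ih, sectorSum_succ_self, geom_sum_eq hr]
    push_cast
    field_simp
    ring

/-- Column `j` of `sectorSum` solves the three-term recursion with source at `j`. -/
theorem sectorSum_recursion (r : ℝ) (i j : ℕ) :
    (r + 1) * sectorSum r (i + 1) j - r * sectorSum r (i + 2) j - sectorSum r i j =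
      if i = j then 1 else 0 := by
  rw [sectorSum_succ r (i + 1), sectorSum_succ r i]
  rcases lt_trichotomy i j with h | h | h
  · obtain ⟨d, rfl⟩ := Nat.exists_eq_add_of_lt h
    rw [if_pos h.le, if_pos (Nat.succ_le_of_lt h), if_neg h.ne,
      show i + d + 1 - i = d + 1 by omega, show i + d + 1 - (i + 1) = d by omega]
    ring
  · subst h
    simp
    ring
  · rw [if_neg (by omega), if_neg (by omega), if_neg (by omega)]
    ring

/-- The last row, where the free boundary condition holds. -/
theorem sectorSum_boundary (r : ℝ) {i j : ℕ} (h : j ≤ i) :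
    sectorSum r (i + 1) j - sectorSum r i j = if i = j then 1 else 0 := by
  rw [sectorSum_succ, add_sub_cancel_left]
  rcases h.eq_or_lt with rfl | h
  · simp
  · rw [if_neg (by omega), if_neg (by omega)]

/-- For `q ≥ 3` and `n ≥ 1`, the `n × n` tridiagonal matrix `S_n` with
diagonal `(q, …, q, 1)`, superdiagonal entries `-(q-1)` and subdiagonal entries `-1`
satisfies `trace(S_n⁻¹) = ((q-1)^{n+1} - (q-1) - n(q-2)) / (q-2)²`. -/
theorem tree_sector_matrix_trace_inverse (q : ℕ) (hq : 3 ≤ q) (n : ℕ) (hn : 1 ≤ n)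
    (S : Matrix (Fin n) (Fin n) ℝ)
    (hS : ∀ i j : Fin n, S i j =
      if i = j then (if (i : ℕ) = n - 1 then 1 else (q : ℝ))
      else if (i : ℕ) + 1 = (j : ℕ) then -((q : ℝ) - 1)
      else if (j : ℕ) + 1 = (i : ℕ) then -1
      else 0) :
    S⁻¹.trace =
      (((q : ℝ) - 1) ^ (n + 1) - ((q : ℝ) - 1) - (n : ℝ) * ((q : ℝ) - 2)) /
        ((q : ℝ) - 2) ^ 2 := by
  set r : ℝ := (q : ℝ) - 1 with hr
  have hqr : (q : ℝ) = r + 1 := by rw [hr]; ring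
  have hr1 : r ≠ 1 := by
    have : (3 : ℝ) ≤ q := by exact_mod_cast hq
    intro h
    linarith
  have hmul : S * Matrix.of (fun i j : Fin n => sectorSum r (i + 1) j) = 1 := by
    ext i j
    have hentry : ∀ k : Fin n, S i k * sectorSum r (k + 1) j =
        (if (k : ℕ) = i then
          (if (i : ℕ) = n - 1 then 1 else (q : ℝ)) * sectorSum r (k + 1) j else 0) +
        (if (k : ℕ) = i + 1 then -r * sectorSum r (k + 1) j else 0) -
        (if (k : ℕ) = i - 1 then (if (i : ℕ) = 0 then 0 else sectorSum r (k + 1) j) else 0) := by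
      intro k
      rw [hS]
      simp only [Fin.ext_iff]
      split_ifs <;> first | omega | ring
    have hi := i.isLt
    have hj := j.isLt
    rw [Matrix.mul_apply]
    simp only [Matrix.of_apply, hentry, Finset.sum_sub_distrib, Finset.sum_add_distrib]
    rw [sum_fin_ite_val_eq n i
        (fun k => (if (i : ℕ) = n - 1 then 1 else (q : ℝ)) * sectorSum r (k + 1) j),
      sum_fin_ite_val_eq n (i + 1) (fun k => -r * sectorSum r (k + 1) j),
      sum_fin_ite_val_eq n (i - 1)
        (fun k => if (i : ℕ) = 0 then 0 else sectorSum r (k + 1) j),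
      if_pos hi, if_pos (show (i : ℕ) - 1 < n by omega)]
    have hpred : (if (i : ℕ) = 0 then 0 else sectorSum r ((i : ℕ) - 1 + 1) j) =
        sectorSum r i j := by
      split_ifs with h
      · rw [h, sectorSum_zero]
      · rw [Nat.sub_add_cancel (Nat.one_le_iff_ne_zero.mpr h)]
    rw [hpred, Matrix.one_apply]
    simp only [Fin.ext_iff]
    by_cases hlast : (i : ℕ) = n - 1
    · rw [if_pos hlast, if_neg (by omega), ← sectorSum_boundary r (by omega)]
      ring
    · rw [if_neg hlast, if_pos (by omega), ← sectorSum_recursion r, hqr]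
      ring
  rw [Matrix.inv_eq_right_inv hmul, Matrix.trace, show (q : ℝ) - 2 = r - 1 by rw [hr]; ring,
    ← sum_sectorSum_succ_self hr1]
  exact Fin.sum_univ_eq_sum_range (fun i => sectorSum r (i + 1) i) n
end

section
/- Let q ≥ 3 and h ≥ 1 be integers, and let T be the (h+1) × (h+1) matrix with rows and columns indexed by 0, 1, …, h and entries: T_{00} = q, T_{01} = −q; for 1 ≤ i ≤ h−1: T_{i,i−1} = −1, T_{ii} = q, T_{i,i+1} = −(q−1); T_{h,h−1} = −1, T_{hh} = 1; all other entries zero. Then every eigenvalue μ ∈ ℂ of T is either 0 or a real number satisfying q − 2√(q−1) < μ < q + 2√(q−1). In particular, the nonzero eigenvalues of T are separated from 0 by a gap independent of h. -/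
open Finset ComplexConjugate

/-- Discrete Green identity for a solution of a Jacobi recurrence with constant off-diagonal
coefficient `-s`, zero diagonal and boundary perturbation `1` at the first site. -/
theorem jacobi_green_identity (s : ℝ) (z : ℂ) (u : ℕ → ℂ) (n : ℕ)
    (hzero : (z - 1) * u 0 = -(s * u 1))
    (hrec : ∀ i < n, z * u (i + 1) = -(s * (u i + u (i + 2)))) :
    z * ((∑ i ∈ range (n + 1), Complex.normSq (u i) : ℝ) : ℂ) =
      ((Complex.normSq (u 0) - s * ∑ i ∈ range n, 2 * (u i * conj (u (i + 1))).re : ℝ) : ℂ)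
        - s * (u (n + 1) * conj (u n)) := by
  induction n with
  | zero =>
    simp only [zero_add, range_one, sum_singleton, range_zero, sum_empty, mul_zero, sub_zero,
      ← Complex.mul_conj]
    linear_combination conj (u 0) * hzero
  | succ n ih =>
    have hprev := ih fun i hi => hrec i (by omega)
    have hn := hrec n (by omega)
    have hre : ((2 * (u n * conj (u (n + 1))).re : ℝ) : ℂ) =
        u n * conj (u (n + 1)) + u (n + 1) * conj (u n) := by
      rw [← Complex.add_conj, map_mul, Complex.conj_conj, mul_comm (conj (u n))]
    have hsq := Complex.mul_conj (u (n + 1))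
    rw [sum_range_succ, sum_range_succ (fun i => 2 * (u i * conj (u (i + 1))).re)]
    rw [Complex.ofReal_sub, Complex.ofReal_mul] at hprev ⊢
    rw [Complex.ofReal_add, Complex.ofReal_add, hre, ← hsq]
    linear_combination hprev + conj (u (n + 1)) * hn

/-- The correlations of neighbouring values are dominated by the total mass. -/
theorem abs_sum_two_re_mul_conj_succ_le (u : ℕ → ℂ) (n : ℕ) :
    |∑ i ∈ range n, 2 * (u i * conj (u (i + 1))).re| ≤
      2 * ∑ i ∈ range (n + 1), Complex.normSq (u i)
        - Complex.normSq (u 0) - Complex.normSq (u n) := by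
  induction n with
  | zero => simp [two_mul]
  | succ n ih =>
    have hstep : |2 * (u n * conj (u (n + 1))).re| ≤
        Complex.normSq (u n) + Complex.normSq (u (n + 1)) := by
      simp only [Complex.normSq_apply, Complex.mul_re, Complex.conj_re, Complex.conj_im]
      rw [abs_le]
      constructor <;>
        nlinarith [sq_nonneg ((u n).re + (u (n + 1)).re), sq_nonneg ((u n).im + (u (n + 1)).im),
          sq_nonneg ((u n).re - (u (n + 1)).re), sq_nonneg ((u n).im - (u (n + 1)).im)]
    rw [sum_range_succ, sum_range_succ (fun i => Complex.normSq (u i)) (n + 1)]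
    linarith [abs_add_le (∑ i ∈ range n, 2 * (u i * conj (u (i + 1))).re)
      (2 * (u n * conj (u (n + 1))).re)]

/-- Eigenvalues of a finite Jacobi matrix with off-diagonal entries `-s`, `s > 1`, and zero
diagonal except for a first entry `1` are real and lie strictly between `-2s` and `2s`. -/
theorem jacobi_eigenvalue_mem_band (s : ℝ) (hs : 1 < s) (z : ℂ) (u : ℕ → ℂ) (n : ℕ)
    (hu : u 0 ≠ 0) (hzero : (z - 1) * u 0 = -(s * u 1))
    (hrec : ∀ i < n, z * u (i + 1) = -(s * (u i + u (i + 2)))) (hend : u (n + 1) = 0) :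
    z.im = 0 ∧ -(2 * s) < z.re ∧ z.re < 2 * s := by
  have hgreen := jacobi_green_identity s z u n hzero hrec
  have hbound := abs_le.1 (abs_sum_two_re_mul_conj_succ_le u n)
  rw [hend, zero_mul, mul_zero, sub_zero] at hgreen
  have hzeropos : 0 < Complex.normSq (u 0) := Complex.normSq_pos.2 hu
  have hnpos := Complex.normSq_nonneg (u n)
  have hS : 0 < ∑ i ∈ range (n + 1), Complex.normSq (u i) :=
    sum_pos' (fun i _ => Complex.normSq_nonneg _) ⟨0, by simp, hzeropos⟩
  generalize (∑ i ∈ range (n + 1), Complex.normSq (u i)) = S at *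
  generalize (∑ i ∈ range n, 2 * (u i * conj (u (i + 1))).re) = R at *
  have him := congrArg Complex.im hgreen
  have hre := congrArg Complex.re hgreen
  rw [Complex.im_mul_ofReal, Complex.ofReal_im] at him
  rw [Complex.re_mul_ofReal, Complex.ofReal_re] at hre
  refine ⟨(mul_eq_zero.1 him).resolve_right hS.ne', ?_, ?_⟩
  · refine lt_of_mul_lt_mul_right (a := S) ?_ hS.le
    nlinarith [mul_le_mul_of_nonneg_left hbound.2 (by linarith : 0 ≤ s),
      mul_nonneg (by linarith : 0 ≤ s) hnpos, mul_pos (by linarith : 0 < s) hzeropos]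
  · refine lt_of_mul_lt_mul_right (a := S) ?_ hS.le
    nlinarith [mul_le_mul_of_nonneg_left hbound.1 (by linarith : 0 ≤ s),
      mul_nonneg (by linarith : 0 ≤ s) hnpos, mul_pos (sub_pos.2 hs) hzeropos]

/-- A sum over `Fin (h + 1)` supported on three consecutive indices. -/
theorem sum_fin_eq_of_support_three {h : ℕ} (g : ℕ → ℂ) (i : ℕ) (hi : i + 2 ≤ h)
    (hg : ∀ j, j ≠ i → j ≠ i + 1 → j ≠ i + 2 → g j = 0) :
    ∑ j : Fin (h + 1), g j = g i + g (i + 1) + g (i + 2) := by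
  rw [Fin.sum_univ_eq_sum_range, ← sum_subset (s₁ := {i, i + 1, i + 2})]
  · rw [sum_insert (by simp), sum_pair (by simp), add_assoc]
  · intro j hj
    simp only [mem_insert, mem_singleton] at hj
    simp only [mem_range]
    omega
  · intro j _ hj
    simp only [mem_insert, mem_singleton, not_or] at hj
    exact hg j hj.1 hj.2.1 hj.2.2

/-- A sum over `Fin (h + 1)` supported on two consecutive indices. -/
theorem sum_fin_eq_of_support_two {h : ℕ} (g : ℕ → ℂ) (i : ℕ) (hi : i + 1 ≤ h)
    (hg : ∀ j ≤ h, j ≠ i → j ≠ i + 1 → g j = 0) :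
    ∑ j : Fin (h + 1), g j = g i + g (i + 1) := by
  rw [Fin.sum_univ_eq_sum_range, ← sum_subset (s₁ := {i, i + 1})]
  · rw [sum_pair (by simp)]
  · intro j hj
    simp only [mem_insert, mem_singleton] at hj
    simp only [mem_range]
    omega
  · intro j hjh hj
    simp only [mem_insert, mem_singleton, not_or] at hj
    exact hg j (by simpa [Nat.lt_succ_iff] using hjh) hj.1 hj.2

/-- The difference equations of the radial tree Laplacian, with reflecting continuation past the
leaves, force a nonzero eigenvalue into the band `(q - 2√(q-1), q + 2√(q-1))`. -/
theorem radial_eigenvalue_mem_band (q : ℝ) (hq : 2 < q) (n : ℕ) (μ : ℂ) (hμ : μ ≠ 0)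
    (f : ℕ → ℂ) (hf : ∃ i ≤ n + 1, f i ≠ 0)
    (hroot : q * (f 0 - f 1) = μ * f 0)
    (hrow : ∀ i ≤ n, -(f i - f (i + 1)) + (q - 1) * (f (i + 1) - f (i + 2)) = μ * f (i + 1))
    (hleaf : f (n + 2) = f (n + 1)) :
    μ.im = 0 ∧ q - 2 * √(q - 1) < μ.re ∧ μ.re < q + 2 * √(q - 1) := by
  have hs : 1 < √(q - 1) := by
    rw [Real.lt_sqrt zero_le_one]
    linarith
  have hsq : (√(q - 1) : ℂ) ^ 2 = q - 1 := by
    rw [← Complex.ofReal_pow, Real.sq_sqrt (by linarith)]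
    push_cast
    rfl
  have hqC : (q : ℂ) - 1 ≠ 0 := by
    exact_mod_cast (by linarith : q - 1 ≠ 0)
  generalize √(q - 1) = s at *
  have hstart : f 0 - f 1 ≠ 0 := by
    intro hdiff
    have hfzero : f 0 = 0 := by
      rw [hdiff, mul_zero] at hroot
      exact (mul_eq_zero.1 hroot.symm).resolve_left hμ
    have hall : ∀ i ≤ n + 1, f i = 0 ∧ f (i + 1) = 0 := by
      intro i
      induction i with
      | zero => exact fun _ => ⟨hfzero, by simpa [hfzero] using hdiff⟩
      | succ i ih =>
        intro hi
        obtain ⟨hi₀, hi₁⟩ := ih (by omega)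
        have hr := hrow i (by omega)
        rw [hi₀, hi₁] at hr
        exact ⟨hi₁, by simpa [hqC] using hr⟩
    obtain ⟨i, hi, hne⟩ := hf
    exact hne (hall i hi).1
  have key := jacobi_eigenvalue_mem_band s hs (μ - q) (fun i => s ^ i * (f i - f (i + 1))) n
    (by simpa using hstart)
    (by
      simp only [pow_zero, pow_one, one_mul, zero_add]
      linear_combination -hroot + hrow 0 (by omega) + (f 1 - f 2) * hsq)
    (by
      intro i hi
      have h₀ := hrow i (by omega)
      have h₁ := hrow (i + 1) (by omega)
      simp only [pow_succ]
      linear_combination (s ^ i * s) * (h₁ - h₀) + s ^ i * s * (f (i + 2) - f (i + 3)) * hsq)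
    (by simp [hleaf])
  simp only [Complex.sub_im, Complex.ofReal_im, sub_zero, Complex.sub_re, Complex.ofReal_re] at key
  exact ⟨key.1, by linarith [key.2.1], by linarith [key.2.2]⟩

/-- For integers `q ≥ 3` and `h ≥ 1`, let `T` be the `(h+1) × (h+1)`
matrix (rows/columns indexed `0, …, h`) with `T₀₀ = q`, `T₀₁ = -q`; for `1 ≤ i ≤ h-1`:
`T_{i,i-1} = -1`, `T_{ii} = q`, `T_{i,i+1} = -(q-1)`; `T_{h,h-1} = -1`, `T_{hh} = 1`;
all other entries zero. Then every (complex) eigenvalue `μ` of `T` is either `0` or a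
real number with `q - 2√(q-1) < μ < q + 2√(q-1)`. -/
theorem tree_symmetric_sector_eigenvalue_gap (q : ℕ) (hq : 3 ≤ q) (h : ℕ) (hh : 1 ≤ h)
    (T : Matrix (Fin (h + 1)) (Fin (h + 1)) ℝ)
    (hT : ∀ i j : Fin (h + 1), T i j =
      if (i : ℕ) = (j : ℕ) then (if (i : ℕ) = h then 1 else (q : ℝ))
      else if (i : ℕ) + 1 = (j : ℕ) then (if (i : ℕ) = 0 then -(q : ℝ) else -((q : ℝ) - 1))
      else if (j : ℕ) + 1 = (i : ℕ) then -1
      else 0) :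
    ∀ (μ : ℂ) (v : Fin (h + 1) → ℂ), v ≠ 0 →
      (T.map (fun x : ℝ => (x : ℂ))).mulVec v = μ • v →
      μ = 0 ∨ (μ.im = 0 ∧
        (q : ℝ) - 2 * Real.sqrt ((q : ℝ) - 1) < μ.re ∧
        μ.re < (q : ℝ) + 2 * Real.sqrt ((q : ℝ) - 1)) := by
  intro μ v hv heig
  by_cases hμ : μ = 0
  · exact Or.inl hμ
  obtain ⟨n, rfl⟩ : ∃ n, h = n + 1 := ⟨h - 1, by omega⟩
  let f : ℕ → ℂ := fun i => v ⟨min i (n + 1), by omega⟩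
  have hfv : ∀ j : Fin (n + 1 + 1), v j = f j := fun j =>
    congrArg v (Fin.ext (by simp only; omega))
  let t : ℕ → ℕ → ℝ := fun i j =>
    if i = j then (if i = n + 1 then 1 else (q : ℝ))
    else if i + 1 = j then (if i = 0 then -(q : ℝ) else -((q : ℝ) - 1))
    else if j + 1 = i then -1
    else 0
  have ht : ∀ i j : ℕ, j ≠ i → j ≠ i + 1 → j + 1 ≠ i → t i j = 0 := by
    intro i j h₀ h₁ h₂
    simp only [t, if_neg h₀.symm, if_neg h₁.symm, if_neg h₂]
  have hrows : ∀ i ≤ n + 1, ∑ j : Fin (n + 1 + 1), (t i j : ℂ) * f j = μ * f i := by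
    intro i hi
    have hrow := congrFun heig ⟨i, by omega⟩
    simpa only [Matrix.mulVec, dotProduct, Matrix.map_apply, hT, hfv, Pi.smul_apply,
      smul_eq_mul] using hrow
  have hleaf : f (n + 2) = f (n + 1) := congrArg v (Fin.ext (by simp))
  refine Or.inr (radial_eigenvalue_mem_band q (by exact_mod_cast hq) n μ hμ f ?_ ?_ ?_ hleaf)
  · obtain ⟨j, hj⟩ := Function.ne_iff.1 hv
    exact ⟨j, by omega, by rwa [← hfv]⟩
  · have hrow := hrows 0 (by omega)
    rw [sum_fin_eq_of_support_two (fun j => (t 0 j : ℂ) * f j) 0 (by omega)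
      (fun j _ h₀ h₁ => by simp [ht 0 j h₀ h₁ (by omega)])] at hrow
    simp [t] at hrow
    linear_combination hrow
  · intro i hi
    have hrow := hrows (i + 1) (by omega)
    have hne : i + 1 + 1 ≠ i := by omega
    rcases hi.lt_or_eq with hlt | rfl
    · rw [sum_fin_eq_of_support_three (fun j => (t (i + 1) j : ℂ) * f j) i (by omega)
        (fun j h₀ h₁ h₂ => by simp [ht (i + 1) j h₁ h₂ (by omega)])] at hrow
      simp [t, hlt.ne, hne] at hrow
      linear_combination hrow
    · rw [sum_fin_eq_of_support_two (fun j => (t (i + 1) j : ℂ) * f j) i (by omega)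
        (fun j hj h₀ h₁ => by simp [ht (i + 1) j h₁ (by omega) (by omega)])] at hrow
      simp [t, hne] at hrow
      rw [hleaf]
      linear_combination hrow
end

section
/- Let q ≥ 3 be an integer. Set N_0 = 1 and N_k = q(q−1)^{k−1} for k ≥ 1; let N(h) = Σ_{k=0}^{h} N_k be the total number of nodes of the regular tree with h levels, and let f(n) = [ (q−1)^{n+1} − (q−1) − n(q−2) ] / (q−2)². Then ( Σ_{k=0}^{h−1} (N_{k+1} − N_k) · f(h−k) ) / ( N(h) · h ) → 1 as h → ∞. (Hence the sum Σ_{α≠0} 1/λ_α over the Laplacian spectrum of the regular tree is asymptotically N·h = Θ(N log N).) -/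
open Finset Filter

/-- Closed form of the total number of nodes, in terms of the branching number `p = q - 1`. -/
lemma sum_level_sizes {p : ℝ} {N : ℕ → ℝ} (hN0 : N 0 = 1)
    (hN : ∀ k, N (k + 1) = (p + 1) * p ^ k) (h : ℕ) :
    (p - 1) * ∑ k ∈ range (h + 1), N k = (p + 1) * p ^ h - 2 := by
  induction h with
  | zero => simp [hN0]; ring
  | succ h ih => rw [sum_range_succ, mul_add, ih, hN]; ring

/-- Closed form of the geometric convolution of the inverse traces `f`. -/
lemma sum_pow_mul_inverse_trace {p : ℝ} {f : ℕ → ℝ}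
    (hf : ∀ n : ℕ, (p - 1) ^ 2 * f n = p ^ (n + 1) - p - n * (p - 1)) (h : ℕ) :
    (p - 1) ^ 2 * ∑ k ∈ range h, (p + 1) * (p - 1) * p ^ k * f (h - k) =
      (p + 1) * (p - 1) * (h + 1) * p ^ (h + 1) - (1 + 2 * p) * (p ^ (h + 1) - 1)
        + (p - 1) * (h + 1) - p * (p ^ (h + 2) - p - (h + 1) * (p - 1)) := by
  induction h with
  | zero => simp; ring
  | succ h ih =>
    have hstep : ∑ k ∈ range (h + 1), (p + 1) * (p - 1) * p ^ k * f (h + 1 - k) =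
        p * ∑ k ∈ range h, (p + 1) * (p - 1) * p ^ k * f (h - k)
          + (p + 1) * (p - 1) * f (h + 1) := by
      rw [sum_range_succ', mul_sum]
      congr 1
      · refine sum_congr rfl fun k _ => ?_
        rw [Nat.add_sub_add_right]
        ring
      · simp
    have hfh := hf (h + 1)
    rw [hstep]
    push_cast at hfh ⊢
    linear_combination p * ih + (p + 1) * (p - 1) * hfh

/-- Closed form of the sum of inverse eigenvalues over the non-symmetric sectors. -/
lemma sum_level_increments_mul_inverse_trace {p : ℝ} {N f : ℕ → ℝ} (hN0 : N 0 = 1)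
    (hN : ∀ k, N (k + 1) = (p + 1) * p ^ k)
    (hf : ∀ n : ℕ, (p - 1) ^ 2 * f n = p ^ (n + 1) - p - n * (p - 1)) (h : ℕ) :
    (p - 1) ^ 2 * ∑ k ∈ range h, (N (k + 1) - N k) * f (h - k) =
      (p + 1) * (p - 1) * h * p ^ h - (1 + 2 * p) * (p ^ h - 1) + (p - 1) * h := by
  cases h with
  | zero => simp
  | succ h =>
    have hstep : ∑ k ∈ range (h + 1), (N (k + 1) - N k) * f (h + 1 - k) =
        ∑ k ∈ range h, (p + 1) * (p - 1) * p ^ k * f (h - k) + p * f (h + 1) := by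
      rw [sum_range_succ']
      congr 1
      · refine sum_congr rfl fun k _ => ?_
        rw [Nat.add_sub_add_right, hN, hN]
        ring
      · simp [hN, hN0]
    have hfh := hf (h + 1)
    have hsum := sum_pow_mul_inverse_trace hf h
    rw [hstep]
    push_cast at hfh ⊢
    linear_combination hsum + p * hfh

/-- For `q ≥ 3`, with `N_0 = 1`, `N_k = q(q-1)^{k-1}` for `k ≥ 1`,
`N(h) = Σ_{k=0}^{h} N_k`, and `f(n) = ((q-1)^{n+1} - (q-1) - n(q-2))/(q-2)²`, one has
`( Σ_{k=0}^{h-1} (N_{k+1} - N_k) f(h-k) ) / ( N(h) · h ) → 1` as `h → ∞`. -/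
theorem tree_inverse_eigenvalue_sum_asymptotics (q : ℕ) (hq : 3 ≤ q)
    (Nk : ℕ → ℝ) (hNk0 : Nk 0 = 1)
    (hNk : ∀ k : ℕ, 1 ≤ k → Nk k = (q : ℝ) * ((q : ℝ) - 1) ^ (k - 1))
    (Ntot : ℕ → ℝ) (hNtot : ∀ h : ℕ, Ntot h = ∑ k ∈ Finset.range (h + 1), Nk k)
    (f : ℕ → ℝ)
    (hf : ∀ n : ℕ, f n =
      (((q : ℝ) - 1) ^ (n + 1) - ((q : ℝ) - 1) - (n : ℝ) * ((q : ℝ) - 2)) /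
        ((q : ℝ) - 2) ^ 2) :
    Tendsto
      (fun h : ℕ =>
        (∑ k ∈ Finset.range h, (Nk (k + 1) - Nk k) * f (h - k)) / (Ntot h * (h : ℝ)))
      atTop (nhds 1) := by
  obtain ⟨p, hp⟩ : ∃ p : ℝ, p = (q : ℝ) - 1 := ⟨_, rfl⟩
  have hq3 : (3 : ℝ) ≤ q := by exact_mod_cast hq
  have hp2 : 2 ≤ p := by linarith
  have hp0 : p ≠ 0 := by linarith
  have hp1 : p - 1 ≠ 0 := by linarith
  have hN (k : ℕ) : Nk (k + 1) = (p + 1) * p ^ k := by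
    rw [hNk (k + 1) (by omega), hp, Nat.add_sub_cancel]
    ring
  have hfp (n : ℕ) : (p - 1) ^ 2 * f n = p ^ (n + 1) - p - n * (p - 1) := by
    have hqp : (q : ℝ) - 2 = p - 1 := by rw [hp]; ring
    rw [hf, ← hp, hqp]
    field_simp
  have hr : Tendsto (fun h : ℕ => p⁻¹ ^ h) atTop (nhds 0) :=
    tendsto_pow_atTop_nhds_zero_of_lt_one (by positivity) (inv_lt_one_of_one_lt₀ (by linarith))
  have hinv : Tendsto (fun h : ℕ => (h : ℝ)⁻¹) atTop (nhds 0) :=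
    tendsto_inv_atTop_nhds_zero_nat
  have hlim : Tendsto (fun h : ℕ =>
      ((p + 1) * (p - 1) - (1 + 2 * p) * (h : ℝ)⁻¹ * (1 - p⁻¹ ^ h) + (p - 1) * p⁻¹ ^ h) /
        ((p - 1) * ((p + 1) - 2 * p⁻¹ ^ h))) atTop (nhds 1) := by
    have hne : (p - 1) * ((p + 1) - 2 * 0) ≠ 0 := mul_ne_zero hp1 (by linarith)
    have key := (((tendsto_const_nhds (x := (p + 1) * (p - 1))).sub
      ((hinv.const_mul (1 + 2 * p)).mul (hr.const_sub 1))).add (hr.const_mul (p - 1))).div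
      (((hr.const_mul 2).const_sub (p + 1)).const_mul (p - 1)) hne
    have hone : ((p + 1) * (p - 1) - (1 + 2 * p) * 0 * (1 - 0) + (p - 1) * 0) /
        ((p - 1) * ((p + 1) - 2 * 0)) = 1 := by
      rw [div_eq_one_iff_eq hne]
      ring
    rw [hone] at key
    exact key
  refine hlim.congr' ?_
  filter_upwards [eventually_ge_atTop 1] with h hh
  have hh0 : (h : ℝ) ≠ 0 := by positivity
  have hpow : p ^ h ≠ 0 := pow_ne_zero h hp0
  have hpow1 : 1 ≤ p ^ h := one_le_pow₀ (by linarith)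
  have hnum := sum_level_increments_mul_inverse_trace hNk0 hN hfp h
  have hden := sum_level_sizes hNk0 hN h
  rw [← hNtot] at hden
  have hdpos : (p + 1) * p ^ h - 2 ≠ 0 := by nlinarith
  have hNne : Ntot h ≠ 0 := by
    intro h0
    exact hdpos (by rw [← hden, h0, mul_zero])
  have hdne : (p + 1) - 2 * p⁻¹ ^ h ≠ 0 := by
    intro h0
    apply hdpos
    rw [inv_pow] at h0
    field_simp at h0
    linarith
  rw [eq_comm, ← mul_div_mul_left _ _ (pow_ne_zero 2 hp1), hnum,
    show (p - 1) ^ 2 * (Ntot h * h) = (p - 1) * ((p + 1) * p ^ h - 2) * h by rw [← hden]; ring,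
    div_eq_div_iff (mul_ne_zero (mul_ne_zero hp1 hdpos) hh0) (mul_ne_zero hp1 hdne), inv_pow]
  field_simp
end
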